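/- arXiv:1009.1029 — 5 statements merged into one kernel-verified Lean document; each statement's English description precedes it below -/
import Mathlib

section
/- Let a, b ∈ ℝ with b ∉ E_a ∪ R_a. If β : ℤ → ℂ is an admissible zero-mean symbol for (a, b) normalized so that β(1) = 1, then b = 2 and β(k) = |k|^a for every nonzero integer k. (This is the Fourier-multiplier form of the statement that the only metric realization of m_t + u m_x + b u_x m = 0, m = (−Δ)^{a/2}u, as an Euler equation on Diff_0^∞(S^1) with Fourier-type inertia operator occurs for b = 2 with inertia operator (−Δ)^{a/2}.) -/
/-- Real power `|n|^a` of the absolute value of an integer. -/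
noncomputable def rpAbs (a : ℝ) (n : ℤ) : ℝ := |(n : ℝ)| ^ a

/-- `β : ℤ → ℂ` is an admissible zero-mean symbol for `(a, b)`:
(i) `β 0 = 0`; (ii) `β k ≠ 0` for `k ≠ 0`;
(iii) for nonzero `j, k` with `j + k ≠ 0`,
  `|j+k|^a (β j (2k+j) + β k (2j+k)) = β (j+k) (b (k|j|^a + j|k|^a) + k|k|^a + j|j|^a)`;
(iv) for nonzero `j, k` with `j + k = 0`, `β j (2k+j) + β k (2j+k) = 0`. -/
def AdmissibleZeroMeanSymbol (a b : ℝ) (β : ℤ → ℂ) : Prop :=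
  β 0 = 0 ∧
  (∀ k : ℤ, k ≠ 0 → β k ≠ 0) ∧
  (∀ j k : ℤ, j ≠ 0 → k ≠ 0 → j + k ≠ 0 →
    (rpAbs a (j + k) : ℂ) * (β j * (2 * (k : ℂ) + (j : ℂ)) + β k * (2 * (j : ℂ) + (k : ℂ))) =
      β (j + k) *
        ((b * ((k : ℝ) * rpAbs a j + (j : ℝ) * rpAbs a k) +
            (k : ℝ) * rpAbs a k + (j : ℝ) * rpAbs a j : ℝ) : ℂ)) ∧
  (∀ j k : ℤ, j ≠ 0 → k ≠ 0 → j + k = 0 →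
    β j * (2 * (k : ℂ) + (j : ℂ)) + β k * (2 * (j : ℂ) + (k : ℂ)) = 0)

/-- The quadratic polynomial `Q_a(b)`. -/
noncomputable def Qpoly (a b : ℝ) : ℝ :=
  7 * ((2 : ℝ) ^ a + 2) * (b - 2) ^ 2 +
    (43 * (2 : ℝ) ^ a + 7 * (3 : ℝ) ^ a - 9 * (6 : ℝ) ^ a + 65) * (b - 2) +
    (60 * (2 : ℝ) ^ a + 15 * (3 : ℝ) ^ a - 21 * (6 : ℝ) ^ a + 75)

theorem rpAbs_pos (a : ℝ) {n : ℤ} (hn : n ≠ 0) : 0 < rpAbs a n :=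
  Real.rpow_pos_of_pos (abs_pos.2 (Int.cast_ne_zero.2 hn)) a

theorem rpAbs_neg (a : ℝ) (n : ℤ) : rpAbs a (-n) = rpAbs a n := by
  simp [rpAbs]

theorem rpAbs_one_right (a : ℝ) : rpAbs a 1 = 1 := by
  simp [rpAbs]

theorem AdmissibleZeroMeanSymbol.map_neg {a b : ℝ} {β : ℤ → ℂ}
    (h : AdmissibleZeroMeanSymbol a b β) (k : ℤ) : β (-k) = β k := by
  rcases eq_or_ne k 0 with rfl | hk
  · simp
  have h₁ := h.2.2.2 k (-k) hk (neg_ne_zero.2 hk) (add_neg_cancel k)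
  push_cast at h₁
  have hk' : (k : ℂ) ≠ 0 := Int.cast_ne_zero.2 hk
  apply mul_left_cancel₀ hk'
  linear_combination h₁

/-- Either `b = 2`, or the order `a` is `1`. -/
theorem AdmissibleZeroMeanSymbol.eq_two_or_eq_one {a b : ℝ} {β : ℤ → ℂ}
    (h : AdmissibleZeroMeanSymbol a b β) (hnorm : β 1 = 1) : b = 2 ∨ a = 1 := by
  have h₁ := h.2.2.1 2 (-1) (by norm_num) (by norm_num) (by norm_num)
  norm_num [h.map_neg, rpAbs_neg, rpAbs_one_right, hnorm] at h₁
  have h₂ : (b - 2) * (rpAbs a 2 - 2) = 0 := by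
    have : (((b - 2) * (rpAbs a 2 - 2) : ℝ) : ℂ) = 0 := by
      push_cast
      linear_combination h₁
    exact_mod_cast this
  refine (mul_eq_zero.1 h₂).imp sub_eq_zero.1 fun h₃ ↦ ?_
  have h₄ : (2 : ℝ) ^ a = 2 ^ (1 : ℝ) := by
    simpa [rpAbs] using sub_eq_zero.1 h₃
  exact (Real.rpow_right_inj (by norm_num) (by norm_num)).1 h₄

theorem AdmissibleZeroMeanSymbol.eq_two_of_order_one {b : ℝ} {β : ℤ → ℂ}
    (h : AdmissibleZeroMeanSymbol 1 b β) (hnorm : β 1 = 1) : b = 2 := by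
  have h₁₁ := h.2.2.1 1 1 (by norm_num) (by norm_num) (by norm_num)
  have h₂₁ := h.2.2.1 2 1 (by norm_num) (by norm_num) (by norm_num)
  have h₃₁ := h.2.2.1 3 (-1) (by norm_num) (by norm_num) (by norm_num)
  have h₂₂ := h.2.2.1 2 2 (by norm_num) (by norm_num) (by norm_num)
  have h₃₂ := h.2.2.1 3 1 (by norm_num) (by norm_num) (by norm_num)
  norm_num [h.map_neg, rpAbs, hnorm] at h₁₁ h₂₁ h₃₁ h₂₂ h₃₂
  have hb : (b : ℂ) + 1 ≠ 0 := by
    intro hb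
    have : (12 : ℂ) = 0 := by linear_combination h₁₁ + 2 * β 2 * hb
    norm_num at this
  have hq : ((b : ℂ) - 2) * (5 * b + 1) = 0 := by
    linear_combination (1 / 4) * ((b + 1) * h₂₁ + (4 * b + 5) * (b + 1) / 2 * h₃₁ +
      (-4 - 8 * b) * h₁₁)
  rcases mul_eq_zero.1 hq with hq | hq
  · exact_mod_cast sub_eq_zero.1 hq
  · exfalso
    have hb' : (b : ℂ) = -1 / 5 := by linear_combination hq / 5
    rw [hb'] at h₁₁ h₂₂ h₃₂
    have hβ₂ : β 2 = 15 / 2 := by linear_combination (-5 / 8) * h₁₁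
    have hβ₃ : β 3 = 25 := by linear_combination h₃₁ / 2 + 4 * hβ₂
    rw [hβ₂] at h₂₂
    rw [hβ₃] at h₃₂
    have : (15 : ℂ) / 4 = 0 := by linear_combination (5 / 44) * h₃₂ - (5 / 32) * h₂₂
    norm_num at this

theorem AdmissibleZeroMeanSymbol.eq_rpAbs_natCast {a : ℝ} {β : ℤ → ℂ}
    (h : AdmissibleZeroMeanSymbol a 2 β) (hnorm : β 1 = 1) {n : ℕ} (hn : 1 ≤ n) :
    β n = rpAbs a n := by
  induction n, hn using Nat.le_induction with
  | base => simp [hnorm, rpAbs_one_right]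
  | succ n hn ih =>
    have h₁ := h.2.2.1 n 1 (by lia) one_ne_zero (by lia)
    rw [ih, hnorm, rpAbs_one_right] at h₁
    push_cast at h₁ ⊢
    have hp : 0 < rpAbs a n := rpAbs_pos a (by lia)
    have hc : ((2 * (rpAbs a n + n) + 1 + n * rpAbs a n : ℝ) : ℂ) ≠ 0 := by
      exact_mod_cast (by positivity : 2 * (rpAbs a n + n) + 1 + n * rpAbs a n ≠ 0)
    apply mul_right_cancel₀ hc
    push_cast
    linear_combination -h₁

theorem metric_realization_zero_mean (a b : ℝ)
    (hE1 : b ≠ -((2 : ℝ) ^ (a + 1) + 1) / ((2 : ℝ) ^ a + 2))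
    (hE2 : b ≠ -((3 : ℝ) ^ (a + 1) + 1) / ((3 : ℝ) ^ a + 3))
    (hR : Qpoly a b ≠ 0)
    (β : ℤ → ℂ) (hβ : AdmissibleZeroMeanSymbol a b β) (hnorm : β 1 = 1) :
    b = 2 ∧ ∀ k : ℤ, k ≠ 0 → β k = (rpAbs a k : ℂ) := by
  have hb : b = 2 := by
    rcases hβ.eq_two_or_eq_one hnorm with hb | rfl
    · exact hb
    · exact hβ.eq_two_of_order_one hnorm
  subst hb
  refine ⟨rfl, fun k hk ↦ ?_⟩
  obtain ⟨n, rfl | rfl⟩ := k.eq_nat_or_neg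
  · exact hβ.eq_rpAbs_natCast hnorm (by lia)
  · rw [hβ.map_neg, rpAbs_neg]
    exact hβ.eq_rpAbs_natCast hnorm (by lia)
end

section
/- Let a, b ∈ ℝ satisfy b ≠ −1, b·(2^a+2) + 2^{a+1} + 1 ≠ 0, and b·(3^a+3) + 3^{a+1} + 1 ≠ 0. Define β(1) = 1 and, for k = 1, 2, 3, β(k+1) = (k+1)^a · (β(k)·(2+k) + 2k+1) / (b·(k^a+k) + k^{a+1} + 1). If β(4) = 9·4^a/(b+1)², then (b−2)·Q_a(b) = 0, i.e. either b = 2 or Q_a(b) = 0. -/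
theorem beta_four_comparison (a b : ℝ) (hb : b ≠ -1)
    (h2 : b * ((2 : ℝ) ^ a + 2) + (2 : ℝ) ^ (a + 1) + 1 ≠ 0)
    (h3 : b * ((3 : ℝ) ^ a + 3) + (3 : ℝ) ^ (a + 1) + 1 ≠ 0)
    (β : ℕ → ℝ) (hβ1 : β 1 = 1)
    (hrec : ∀ k : ℕ, 1 ≤ k → k ≤ 3 →
      β (k + 1) = ((k : ℝ) + 1) ^ a * (β k * (2 + (k : ℝ)) + 2 * (k : ℝ) + 1) /
        (b * ((k : ℝ) ^ a + (k : ℝ)) + (k : ℝ) ^ (a + 1) + 1))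
    (h4 : β 4 = 9 * (4 : ℝ) ^ a / (b + 1) ^ 2) :
    (b - 2) * Qpoly a b = 0 := by
  have hb1 : b + 1 ≠ 0 := fun h => hb (by linarith)
  have h6 : (6 : ℝ) ^ a = (2 : ℝ) ^ a * (3 : ℝ) ^ a := by
    rw [← Real.mul_rpow (by norm_num) (by norm_num)]
    norm_num
  rw [Real.rpow_add_one (by norm_num)] at h2 h3
  have e1 := hrec 1 le_rfl (by norm_num)
  have e2 := hrec 2 (by norm_num) (by norm_num)
  have e3 := hrec 3 (by norm_num) le_rfl
  norm_num [hβ1, Real.rpow_add_one] at e1 e2 e3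
  have h4pos : (0 : ℝ) < (4 : ℝ) ^ a := by positivity
  rw [h4] at e3
  unfold Qpoly
  rw [h6]
  generalize (2 : ℝ) ^ a = x at *
  generalize (3 : ℝ) ^ a = y at *
  generalize (4 : ℝ) ^ a = z at *
  have hβ2 : β 2 * (b + 1) = 3 * x := by
    rw [e1, show b * 2 + 1 + 1 = 2 * (b + 1) by ring]
    field_simp
    ring
  have hβ3 : β 3 * (b * (x + 2) + x * 2 + 1) = y * (β 2 * 4 + 5) := by
    rw [e2, div_mul_eq_mul_div, div_eq_iff h2]
    ring
  have hβ4 : 9 * (b * (y + 3) + y * 3 + 1) = (b + 1) ^ 2 * (β 3 * 5 + 7) := by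
    rw [div_eq_div_iff (by positivity) h3] at e3
    apply mul_left_cancel₀ h4pos.ne'
    linear_combination e3
  linear_combination -(b * (x + 2) + x * 2 + 1) * hβ4 - 5 * (b + 1) ^ 2 * hβ3
    - 20 * y * (b + 1) * hβ2
end

section
/- For every a ∈ ℝ the quadratic polynomial Q_a has a real root: there exists b ∈ ℝ with 7·(2^a+2)·(b−2)² + (43·2^a + 7·3^a − 9·6^a + 65)·(b−2) + (60·2^a + 15·3^a − 21·6^a + 75) = 0. In particular the exceptional set R_a = {b ∈ ℝ : Q_a(b) = 0} is nonempty for every a ∈ ℝ. -/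
/-- A real quadratic polynomial with positive leading coefficient that takes a nonpositive value
has a real root. -/
theorem exists_quadratic_eq_zero_of_nonpos {A B C t : ℝ} (hA : 0 < A)
    (ht : A * t ^ 2 + B * t + C ≤ 0) : ∃ x : ℝ, A * x ^ 2 + B * x + C = 0 := by
  have hdisc : 0 ≤ discrim A B C := by
    unfold discrim
    nlinarith [sq_nonneg (2 * A * t + B), mul_nonneg hA.le (neg_nonneg.mpr ht)]
  obtain ⟨x, hx⟩ := exists_quadratic_eq_zero hA.ne'
    ⟨√(discrim A B C), (Real.mul_self_sqrt hdisc).symm⟩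
  exact ⟨x, by linarith [hx]⟩

theorem Qpoly_has_real_root (a : ℝ) : ∃ b : ℝ, Qpoly a b = 0 := by
  have h2 : (0 : ℝ) < 2 ^ a := by positivity
  have h3 : (0 : ℝ) < 3 ^ a := by positivity
  -- At `b = -1/3` the coefficient of `6 ^ a` vanishes and the other coefficients are negative.
  obtain ⟨x, hx⟩ := exists_quadratic_eq_zero_of_nonpos (A := 7 * ((2 : ℝ) ^ a + 2))
    (B := 43 * (2 : ℝ) ^ a + 7 * (3 : ℝ) ^ a - 9 * (6 : ℝ) ^ a + 65)
    (C := 60 * (2 : ℝ) ^ a + 15 * (3 : ℝ) ^ a - 21 * (6 : ℝ) ^ a + 75)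
    (t := -7 / 3) (by positivity) (by linarith)
  exact ⟨x + 2, by simpa only [Qpoly, add_sub_cancel_right] using hx⟩
end

section
/- For every integer d ≥ 2, there is no sequence β : ℤ → ℂ that is an admissible zero-mean symbol for (a, b) = (2, (d−3)/(d−1)). (This is the Fourier-multiplier form of the statement that the axisymmetric Euler flow in ℝ^d, described by m_t + u m_x + ((d−3)/(d−1))·u_x m = 0 with m = −u_xx and u a smooth zero-mean function on the circle, cannot be realized as a metric Euler equation on Diff_0^∞(S^1) for any regular inertia operator of Fourier type.) -/
lemma rpAbs_two (n : ℤ) : rpAbs 2 n = (n : ℝ) ^ 2 := by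
  simp [rpAbs]

/-- For `a = 2`, an admissible zero-mean symbol can only exist when `b = 2`. -/
lemma AdmissibleZeroMeanSymbol.eq_two {b : ℝ} {β : ℤ → ℂ}
    (h : AdmissibleZeroMeanSymbol 2 b β) : b = 2 := by
  obtain ⟨-, hne, hadd, hanti⟩ := h
  have heven := hanti 1 (-1) (by norm_num) (by norm_num) (by norm_num)
  have hrel := hadd 2 (-1) (by norm_num) (by norm_num) (by norm_num)
  simp only [rpAbs_two] at hrel
  norm_num at heven hrel
  have hb : β 1 * ((b : ℂ) - 2) = 0 := by
    linear_combination hrel / 2 - (3 / 2 : ℂ) * heven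
  have hb' : (b : ℂ) = 2 := sub_eq_zero.mp ((mul_eq_zero.mp hb).resolve_left (hne 1 one_ne_zero))
  exact_mod_cast hb'

theorem axisymmetric_euler_not_metric (d : ℤ) (hd : 2 ≤ d) :
    ¬ ∃ β : ℤ → ℂ, AdmissibleZeroMeanSymbol 2 (((d : ℝ) - 3) / ((d : ℝ) - 1)) β := by
  rintro ⟨β, h⟩
  have hd' : (2 : ℝ) ≤ d := by exact_mod_cast hd
  have hb := h.eq_two
  rw [div_eq_iff (by linarith)] at hb
  linarith
end

section
/- Let b ∈ ℝ with b ∉ {−5/3, −5/4}. If β : ℤ → ℂ is an admissible symbol for (a, b) = (1, b) normalized so that β(0) = 1, then b = 2 and β(k) = |k| for every nonzero integer k. (This is the Fourier-multiplier form of the statement that the family m_t + u m_x + b u_x m = 0 with m = (−Δ)^{1/2}u + ∫u can be realized as a metric Euler equation on Diff^∞(S^1) with Fourier-type inertia operator only for b = 2, with inertia operator (−Δ)^{1/2} + μ.) -/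
/-- The symbol `λ` of the inertia operator `Λ^a_μ = (−Δ)^{a/2} + μ(·)`:
`λ(0) = 1` and `λ(m) = |m|^a` (real power) for `m ≠ 0`. -/
noncomputable def lamSymbol (a : ℝ) (m : ℤ) : ℝ := if m = 0 then 1 else |(m : ℝ)| ^ a

/-- `β : ℤ → ℂ` is an admissible symbol for `(a, b)`: `β k ≠ 0` for all `k`, and for all `j, k`,
`λ(j+k)·(β j·(2k+j) + β k·(2j+k)) = β (j+k)·(b·(k·λ(j) + j·λ(k)) + k·λ(k) + j·λ(j))`. -/
def AdmissibleSymbol (a b : ℝ) (β : ℤ → ℂ) : Prop :=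
  (∀ k : ℤ, β k ≠ 0) ∧
  (∀ j k : ℤ,
    (lamSymbol a (j + k) : ℂ) *
        (β j * (2 * (k : ℂ) + (j : ℂ)) + β k * (2 * (j : ℂ) + (k : ℂ))) =
      β (j + k) *
        ((b * ((k : ℝ) * lamSymbol a j + (j : ℝ) * lamSymbol a k) +
            (k : ℝ) * lamSymbol a k + (j : ℝ) * lamSymbol a j : ℝ) : ℂ))

theorem lamSymbol_one_of_ne_zero {k : ℤ} (hk : k ≠ 0) : lamSymbol 1 k = |(k : ℝ)| := by
  simp [lamSymbol, hk]

/-- Pairing a nonzero frequency with the zero frequency determines an admissible symbol. -/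
theorem AdmissibleSymbol.mul_eq_two_mul_lamSymbol {a b : ℝ} {β : ℤ → ℂ}
    (hβ : AdmissibleSymbol a b β) (hnorm : β 0 = 1) {k : ℤ} (hk : k ≠ 0) :
    (b : ℂ) * β k = 2 * (lamSymbol a k : ℂ) := by
  have h := hβ.2 0 k
  have h0 : lamSymbol a 0 = 1 := by simp [lamSymbol]
  rw [zero_add, hnorm, h0] at h
  push_cast at h
  have hk' : (k : ℂ) ≠ 0 := by exact_mod_cast hk
  apply mul_left_cancel₀ hk'
  linear_combination -h

theorem first_order_metric_realization (b : ℝ) (hb1 : b ≠ -5/3) (hb2 : b ≠ -5/4)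
    (β : ℤ → ℂ) (hβ : AdmissibleSymbol 1 b β) (hnorm : β 0 = 1) :
    b = 2 ∧ ∀ k : ℤ, k ≠ 0 → β k = ((|(k : ℝ)| : ℝ) : ℂ) := by
  have hmul {k : ℤ} (hk : k ≠ 0) : (b : ℂ) * β k = 2 * ((|(k : ℝ)| : ℝ) : ℂ) := by
    rw [hβ.mul_eq_two_mul_lamSymbol hnorm hk, lamSymbol_one_of_ne_zero hk]
  have hβ1 : (b : ℂ) * β 1 = 2 := by simpa using hmul one_ne_zero
  have hβ2 : (b : ℂ) * β 2 = 4 := by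
    rw [hmul two_ne_zero]
    norm_num
  have h11 := hβ.2 1 1
  rw [one_add_one_eq_two, lamSymbol_one_of_ne_zero one_ne_zero,
    lamSymbol_one_of_ne_zero two_ne_zero] at h11
  norm_num at h11
  have hb : b = 2 := by
    have hbC : (b : ℂ) = 2 := by
      linear_combination (-(b : ℂ) / 8) * h11 + (3 / 2) * hβ1 - ((2 * b + 2 : ℂ) / 8) * hβ2
    exact_mod_cast hbC
  refine ⟨hb, fun k hk => ?_⟩
  have h := hmul hk
  rw [hb] at h
  exact mul_left_cancel₀ two_ne_zero (by exact_mod_cast h)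
end
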